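/- For every integer n ≥ 3, every real κ with 0 < κ ≤ 1, and every constant C > 0, there exists a constant c > 0 (depending only on n, κ, C) such that for all y > 0: if A := ∫_0^{log(cosh y / sinh y)} (sinh(κt)/κ)^{n−2} dt satisfies A ≥ C, then 2A · ∫_0^y (cosh(κt))^{n−1} dt ≥ c · A^{1−1/(κ(n−2))}. -/

import Mathlib

/-- On `[0, ∞)`, `tanh` lies below the identity. -/
theorem sinh_le_mul_cosh {y : ℝ} (hy : 0 ≤ y) : Real.sinh y ≤ y * Real.cosh y := by
  have hmono : MonotoneOn (fun x : ℝ => x * Real.cosh x - Real.sinh x) (Set.Ici 0) := by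
    refine monotoneOn_of_hasDerivWithinAt_nonneg (f' := fun x => x * Real.sinh x)
      (convex_Ici 0) (by fun_prop) (fun x _ => ?_) (fun x hx => ?_)
    · have h := (((hasDerivAt_id x).mul (Real.hasDerivAt_cosh x)).sub (Real.hasDerivAt_sinh x))
      refine (h.congr_deriv ?_).hasDerivWithinAt
      simp
    · rw [interior_Ici] at hx
      exact mul_nonneg hx.le (Real.sinh_nonneg_iff.2 hx.le)
  have h := hmono (Set.mem_Ici.2 le_rfl) (Set.mem_Ici.2 hy) hy
  simp only [zero_mul, Real.sinh_zero, sub_zero] at h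
  linarith

/-- The interval `[0, y]` bounds from below the integral of a power of `cosh`. -/
theorem le_integral_cosh_pow (κ : ℝ) (k : ℕ) {y : ℝ} (hy : 0 ≤ y) :
    y ≤ ∫ t in (0:ℝ)..y, (Real.cosh (κ * t)) ^ k := by
  have h : ∫ _ in (0:ℝ)..y, (1:ℝ) ≤ ∫ t in (0:ℝ)..y, (Real.cosh (κ * t)) ^ k := by
    refine intervalIntegral.integral_mono_on hy (by simp)
      (Continuous.intervalIntegrable (by fun_prop) _ _) fun t _ => ?_
    exact one_le_pow₀ (Real.one_le_cosh _)
  simpa using h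

/-- Lower bound of exponential type for the integral of a power of `sinh (κ t) / κ`. -/
theorem exp_pow_le_integral_sinh_pow {κ : ℝ} (hκ : 0 < κ) (m : ℕ) {L : ℝ} (hL : 2 ≤ L) :
    (Real.exp (-κ) * (1 - Real.exp (-(2 * κ))) / (2 * κ) * Real.exp (κ * L)) ^ m ≤
      ∫ t in (0:ℝ)..L, (Real.sinh (κ * t) / κ) ^ m := by
  have hcont : Continuous fun t : ℝ => (Real.sinh (κ * t) / κ) ^ m := by fun_prop
  have hbase : Real.exp (-κ) * (1 - Real.exp (-(2 * κ))) / (2 * κ) * Real.exp (κ * L) ≤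
      Real.sinh (κ * (L - 1)) / κ := by
    have h1 : Real.exp (-(κ * (L - 1))) ≤ Real.exp (κ * (L - 1)) * Real.exp (-(2 * κ)) := by
      rw [← Real.exp_add]
      exact Real.exp_le_exp.2 (by nlinarith)
    have h2 : Real.exp (κ * (L - 1)) = Real.exp (-κ) * Real.exp (κ * L) := by
      rw [← Real.exp_add]
      ring_nf
    rw [Real.sinh_eq, div_mul_eq_mul_div, div_div]
    refine div_le_div_of_nonneg_right ?_ (by positivity)
    rw [h2] at h1 ⊢
    linarith
  have hone : 0 ≤ 1 - Real.exp (-(2 * κ)) := by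
    have : Real.exp (-(2 * κ)) ≤ 1 := Real.exp_le_one_iff.2 (by linarith)
    linarith
  calc _ ≤ (Real.sinh (κ * (L - 1)) / κ) ^ m := pow_le_pow_left₀ (by positivity) hbase m
    _ = ∫ _ in (L - 1)..L, (Real.sinh (κ * (L - 1)) / κ) ^ m := by simp
    _ ≤ ∫ t in (L - 1)..L, (Real.sinh (κ * t) / κ) ^ m := by
      refine intervalIntegral.integral_mono_on (by linarith) (by simp)
        (hcont.intervalIntegrable _ _) fun t ht => ?_
      have h0 : 0 ≤ Real.sinh (κ * (L - 1)) :=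
        Real.sinh_nonneg_iff.2 (mul_nonneg hκ.le (by linarith))
      have h1 : Real.sinh (κ * (L - 1)) ≤ Real.sinh (κ * t) :=
        Real.sinh_le_sinh.2 (mul_le_mul_of_nonneg_left ht.1 hκ.le)
      gcongr
    _ ≤ ∫ t in (0:ℝ)..L, (Real.sinh (κ * t) / κ) ^ m := by
      refine intervalIntegral.integral_mono_interval (by linarith) (by linarith) le_rfl ?_
        (hcont.intervalIntegrable _ _)
      refine (MeasureTheory.ae_restrict_iff' measurableSet_Ioc).2 (.of_forall fun t ht => ?_)
      have h0 : 0 ≤ Real.sinh (κ * t) :=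
        Real.sinh_nonneg_iff.2 (mul_nonneg hκ.le ht.1.le)
      exact pow_nonneg (div_nonneg h0 hκ.le) m


/-- For every integer `n ≥ 3`, `0 < κ ≤ 1`, and every constant `C > 0`, there exists
`c > 0` such that for all `y > 0`: if
`A := ∫_0^{log (cosh y / sinh y)} (sinh (κt)/κ)^(n-2) dt` satisfies `A ≥ C`, then
`2A · ∫_0^y (cosh (κt))^(n-1) dt ≥ c · A^(1 - 1/(κ(n-2)))`. -/
theorem stmt_9 (n : ℕ) (hn : 3 ≤ n) (κ : ℝ) (hκ : 0 < κ) (hκ1 : κ ≤ 1)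
    (C : ℝ) (hC : 0 < C) :
    ∃ c : ℝ, 0 < c ∧ ∀ y : ℝ, 0 < y →
      (∫ t in (0:ℝ)..(Real.log (Real.cosh y / Real.sinh y)),
          (Real.sinh (κ * t) / κ) ^ (n - 2)) ≥ C →
      2 * (∫ t in (0:ℝ)..(Real.log (Real.cosh y / Real.sinh y)),
            (Real.sinh (κ * t) / κ) ^ (n - 2)) *
          (∫ t in (0:ℝ)..y, (Real.cosh (κ * t)) ^ (n - 1)) ≥
        c * (∫ t in (0:ℝ)..(Real.log (Real.cosh y / Real.sinh y)),
            (Real.sinh (κ * t) / κ) ^ (n - 2)) ^ (1 - 1 / (κ * ((n : ℝ) - 2))) := by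
  have hm : (0:ℝ) < ((n - 2 : ℕ) : ℝ) := by
    exact_mod_cast (by omega : 0 < n - 2)
  have hmcast : (n : ℝ) - 2 = ((n - 2 : ℕ) : ℝ) := by
    rw [Nat.cast_sub (by omega)]
    norm_num
  rw [hmcast]
  set m := n - 2
  set k := Real.exp (-κ) * (1 - Real.exp (-(2 * κ))) / (2 * κ)
  have hk : 0 < k := by
    have : Real.exp (-(2 * κ)) < 1 := Real.exp_lt_one_iff.2 (by linarith)
    have : 0 < 1 - Real.exp (-(2 * κ)) := by linarith
    positivity
  set p := 1 / (κ * (m : ℝ))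
  have hp : 0 < p := by positivity
  refine ⟨2 * min (k ^ (1 / κ)) (C ^ p * Real.exp (-2)), by positivity, fun y hy hA => ?_⟩
  set L := Real.log (Real.cosh y / Real.sinh y)
  set A := ∫ t in (0:ℝ)..L, (Real.sinh (κ * t) / κ) ^ m
  set I := ∫ t in (0:ℝ)..y, (Real.cosh (κ * t)) ^ (n - 1)
  have hI : y ≤ I := le_integral_cosh_pow κ (n - 1) hy.le
  have hApos : 0 < A := hC.trans_le hA
  have hmin : min (k ^ (1 / κ)) (C ^ p * Real.exp (-2)) ≤ y * A ^ p := by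
    rcases le_total (Real.exp (-2)) y with hy2 | hy2
    · refine (min_le_right _ _).trans ?_
      rw [mul_comm]
      gcongr
    · refine (min_le_left _ _).trans ?_
      have hsinh : 0 < Real.sinh y := Real.sinh_pos_iff.2 hy
      have hcosh : 0 < Real.cosh y := Real.cosh_pos y
      have hyL : 1 / y ≤ Real.exp L := by
        rw [Real.exp_log (by positivity), div_le_div_iff₀ hy hsinh]
        linarith [sinh_le_mul_cosh hy.le]
      have hL : 2 ≤ L := by
        rw [← Real.exp_le_exp]
        refine le_trans ?_ hyL
        rw [le_div_iff₀ hy]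
        calc Real.exp 2 * y ≤ Real.exp 2 * Real.exp (-2) := by gcongr
          _ = 1 := by rw [← Real.exp_add]; simp
      have hpow : k ^ (1 / κ) * Real.exp L = ((k * Real.exp (κ * L)) ^ m) ^ p := by
        have hmp : (m : ℝ) * p = 1 / κ := by
          simp only [p]
          field_simp
        rw [← Real.rpow_natCast, ← Real.rpow_mul (by positivity), hmp,
          Real.mul_rpow hk.le (Real.exp_pos _).le, ← Real.exp_mul]
        congr 2
        field_simp
      have hlow : k ^ (1 / κ) * Real.exp L ≤ A ^ p := by
        rw [hpow]
        exact Real.rpow_le_rpow (by positivity) (exp_pow_le_integral_sinh_pow hκ m hL) hp.le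
      calc k ^ (1 / κ) = y * (k ^ (1 / κ) * (1 / y)) := by field_simp
        _ ≤ y * (k ^ (1 / κ) * Real.exp L) := by gcongr
        _ ≤ y * A ^ p := by gcongr
  have hAp : 0 < A ^ p := Real.rpow_pos_of_pos hApos p
  rw [ge_iff_le, Real.rpow_sub hApos, Real.rpow_one, mul_div_assoc', div_le_iff₀ hAp]
  calc 2 * min (k ^ (1 / κ)) (C ^ p * Real.exp (-2)) * A ≤ 2 * (y * A ^ p) * A := by gcongr
    _ ≤ 2 * (I * A ^ p) * A := by gcongr
    _ = 2 * A * I * A ^ p := by ring
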